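/- A finite eulerian graph G (a finite connected simple graph with all vertex degrees even) admits a rooted 3-odd decomposition if and only if G has an odd number of edges and admits an undirected nowhere-zero integer 3-flow. -/

import Mathlib

open SimpleGraph

/-- An eulerian subgraph of `G`: a connected (hence vertex-nonempty) subgraph of `G`
in which every vertex has even degree. -/
def IsEulerianSubgraph {V : Type*} (G : SimpleGraph V) (H : G.Subgraph) : Prop :=
  H.Connected ∧ ∀ v ∈ H.verts, Even ((H.neighborSet v).ncard)

/-- A `k`-odd decomposition of `G`: a partition of the edge set of `G` into the edge
sets of `k` eulerian subgraphs, each having an odd number of edges. -/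
def IsKOddDecomposition {V : Type*} (G : SimpleGraph V) (k : ℕ)
    (D : Fin k → G.Subgraph) : Prop :=
  (∀ i, IsEulerianSubgraph G (D i)) ∧
  (∀ i, Odd ((D i).edgeSet.ncard)) ∧
  (∀ i j, i ≠ j → Disjoint ((D i).edgeSet) ((D j).edgeSet)) ∧
  (⋃ i, (D i).edgeSet) = G.edgeSet

/-- A rooted `k`-odd decomposition: a `k`-odd decomposition all of whose constituents
share a common vertex. -/
def IsRootedKOddDecomposition {V : Type*} (G : SimpleGraph V) (k : ℕ)
    (D : Fin k → G.Subgraph) : Prop :=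
  IsKOddDecomposition G k D ∧ ∃ v : V, ∀ i, v ∈ (D i).verts


namespace OddDec
open Finset Relation

lemma even_card_invol {α : Type*} [DecidableEq α] (S : Finset α) (g : α → α)
    (h1 : ∀ a ∈ S, g a ∈ S) (h2 : ∀ a ∈ S, g (g a) = a) (h3 : ∀ a ∈ S, g a ≠ a) :
    Even S.card := by
  have h : ∑ a ∈ S, (1 : ZMod 2) = 0 := by
    refine Finset.sum_involution (fun a _ => g a) ?_ ?_ ?_ ?_
    · intro a ha; decide
    · intro a ha _; exact h3 a ha
    · intro a ha; exact h1 a ha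
    · intro a ha; exact h2 a ha
  rw [Finset.sum_const, nsmul_eq_mul, mul_one] at h
  exact (ZMod.natCast_eq_zero_iff_even).1 h

/-- orbit relation generated by two maps -/
def orel {α : Type*} (σ τ : α → α) : Setoid α := EqvGen.setoid (fun x y => y = σ x ∨ y = τ x)

lemma orel_s {α : Type*} (σ τ : α → α) (x : α) : (orel σ τ) x (σ x) :=
  EqvGen.rel _ _ (Or.inl rfl)
lemma orel_t {α : Type*} (σ τ : α → α) (x : α) : (orel σ τ) x (τ x) :=
  EqvGen.rel _ _ (Or.inr rfl)

lemma orel_ind {α : Type*} {σ τ : α → α} (P : α → Prop)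
    (hs : ∀ x, P x ↔ P (σ x)) (ht : ∀ x, P x ↔ P (τ x)) {x y : α} (h : (orel σ τ) x y) :
    P x ↔ P y := by
  induction h with
  | rel x y h => rcases h with rfl | rfl; exacts [hs x, ht x]
  | refl x => rfl
  | symm x y _ ih => exact ih.symm
  | trans x y z _ _ ih1 ih2 => exact ih1.trans ih2

lemma orbit_two {α : Type*} [Fintype α] [DecidableEq α] (σ τ : α → α)
    (hs : ∀ x, σ (σ x) = x) (hs' : ∀ x, σ x ≠ x) (ht : ∀ x, τ (τ x) = x) (d : α) (hd : τ d = d)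
    [DecidablePred fun x => (orel σ τ) d x] :
    (univ.filter (fun x => (orel σ τ) d x ∧ τ x = x)).card = 2 := by
  let s : Equiv.Perm α := ⟨σ, σ, hs, hs⟩
  let t : Equiv.Perm α := ⟨τ, τ, ht, ht⟩
  have hss : s * s = 1 := by ext x; exact hs x
  have htt : t * t = 1 := by ext x; exact ht x
  have hsi : s⁻¹ = s := inv_eq_of_mul_eq_one_left hss
  have hti : t⁻¹ = t := inv_eq_of_mul_eq_one_left htt
  let p := s * t
  have hpi : p⁻¹ = t * s := by simp [p, mul_inv_rev, hsi, hti]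
  have hconj : ∀ k : ℤ, t * p ^ k = p ^ (-k) * t := by
    intro k
    have h1 : t * p * t⁻¹ = p⁻¹ := by
      rw [hpi, hti]; simp only [p, mul_assoc, htt, mul_one]
    have h2 := conj_zpow (i := k) (a := t) (b := p)
    rw [h1, inv_zpow, ← zpow_neg] at h2
    rw [h2]; group
  have htk : ∀ k : ℤ, τ ((p ^ k) d) = (p ^ (-k)) d := by
    intro k
    have := congrArg (fun q : Equiv.Perm α => q d) (hconj k)
    simp only [Equiv.Perm.mul_apply] at this
    change τ ((p ^ k) d) = (p ^ (-k)) (τ d) at this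
    rwa [hd] at this
  have hsk : ∀ k : ℤ, σ ((p ^ k) d) = (p ^ (1 - k)) d := by
    intro k
    have : σ ((p ^ k) d) = p (τ ((p ^ k) d)) := by
      change _ = σ (τ (τ _)); rw [ht]
    rw [this, htk, sub_eq_add_neg, zpow_add, zpow_one]; rfl
  have horb : ∀ x, (orel σ τ) d x → ∃ k : ℤ, (p ^ k) d = x := by
    intro x hx
    refine (orel_ind (fun x => ∃ k : ℤ, (p ^ k) d = x) ?_ ?_ hx).1 ⟨0, by simp⟩
    · intro x; constructor
      · rintro ⟨k, rfl⟩; exact ⟨1 - k, (hsk k).symm⟩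
      · rintro ⟨k, hk⟩; exact ⟨1 - k, by rw [← hsk, hk, hs]⟩
    · intro x; constructor
      · rintro ⟨k, rfl⟩; exact ⟨- k, (htk k).symm⟩
      · rintro ⟨k, hk⟩; exact ⟨- k, by rw [← htk, hk, ht]⟩
  have hper : ∀ n : ℤ, (p ^ n) d = d ↔ (Function.minimalPeriod (p • ·) d : ℤ) ∣ n := by
    intro n
    exact MulAction.zpow_smul_eq_iff_minimalPeriod_dvd (a := p) (b := d) (n := n)
  have hfix : ∀ k : ℤ, τ ((p ^ k) d) = (p ^ k) d → (p ^ (2 * k)) d = d := by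
    intro k hk
    rw [htk] at hk
    have : (p ^ k) ((p ^ (-k)) d) = (p ^ k) ((p ^ k) d) := by rw [hk]
    rw [← Equiv.Perm.mul_apply, ← Equiv.Perm.mul_apply, ← zpow_add, ← zpow_add] at this
    simp at this
    rw [two_mul]; exact this.symm
  set F := univ.filter (fun x => (orel σ τ) d x ∧ τ x = x) with hF
  have hdF : d ∈ F := by simp [hF, hd]
  have hle : (F.erase d).card ≤ 1 := by
    rw [Finset.card_le_one]
    intro x hx y hy
    simp only [hF, mem_erase, mem_filter, mem_univ, true_and] at hx hy
    obtain ⟨hx0, hx1, hx2⟩ := hx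
    obtain ⟨hy0, hy1, hy2⟩ := hy
    obtain ⟨j, rfl⟩ := horb x hx1
    obtain ⟨k, rfl⟩ := horb y hy1
    have h1 := (hper _).1 (hfix j hx2)
    have h2 := (hper _).1 (hfix k hy2)
    rw [Ne, hper] at hx0 hy0
    generalize (Function.minimalPeriod (p • ·) d : ℤ) = N at *
    have key : N ∣ k - j := by
      obtain ⟨a, ha⟩ := h1
      obtain ⟨b, hb⟩ := h2
      rcases Int.even_or_odd' a with ⟨a', rfl | rfl⟩
      · exact absurd ⟨a', by linarith⟩ hx0
      rcases Int.even_or_odd' b with ⟨b', rfl | rfl⟩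
      · exact absurd ⟨b', by linarith⟩ hy0
      exact ⟨b' - a', by linarith⟩
    have h3 := (hper _).2 key
    have : (p ^ j) ((p ^ (k - j)) d) = (p ^ j) d := by rw [h3]
    rw [← Equiv.Perm.mul_apply, ← zpow_add] at this
    simp at this
    exact this.symm
  have hev : Even F.card := by
    have e1 : Even (univ.filter (fun x => (orel σ τ) d x)).card := by
      refine even_card_invol _ σ ?_ (fun a _ => hs a) (fun a _ => hs' a)
      intro a ha
      simp only [mem_filter, mem_univ, true_and] at ha ⊢
      exact (orel σ τ).trans ha (orel_s σ τ a)
    have e2 : Even (univ.filter (fun x => (orel σ τ) d x ∧ ¬ τ x = x)).card := by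
      refine even_card_invol _ τ ?_ (fun a _ => ht a) ?_
      · intro a ha
        simp only [mem_filter, mem_univ, true_and] at ha ⊢
        refine ⟨(orel σ τ).trans ha.1 (orel_t σ τ a), ?_⟩
        rw [ht]; exact fun h => ha.2 h.symm
      · intro a ha
        simp only [mem_filter, mem_univ, true_and] at ha
        exact ha.2
    have := Finset.card_filter_add_card_filter_not (s := univ.filter (fun x => (orel σ τ) d x)) (fun x => τ x = x)
    rw [Finset.filter_filter, Finset.filter_filter] at this
    rw [← this] at e1
    exact (Nat.even_add.1 e1).2 e2
  have h4 := Finset.card_erase_add_one hdF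
  obtain ⟨m, hm⟩ := hev
  omega

section
open scoped Classical

/-- A mod 3 flow with values `± 1` on the dart set. -/
structure FlowData {α V : Type*} [Fintype α] (σ : α → α) (π : α → V) (f : α → ℤ) : Prop where
  pm : ∀ a, f a = 1 ∨ f a = -1
  inv : ∀ a, f (σ a) = f a
  div : ∀ v, (3 : ℤ) ∣ ∑ a with π a = v, f a

/-- A maximal pairing of darts with opposite signs at each vertex. -/
structure Matched {α V : Type*} (π : α → V) (f : α → ℤ) (τ : α → α) : Prop where
  invol : ∀ a, τ (τ a) = a
  pi : ∀ a, π (τ a) = π a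
  anti : ∀ a, τ a ≠ a → f (τ a) = - f a
  fix : ∀ a b, τ a = a → τ b = b → π a = π b → f a = f b

lemma matched_exists {α V : Type*} [Fintype α] (π : α → V) (f : α → ℤ)
    (hf : ∀ a, f a = 1 ∨ f a = -1) : ∃ τ, Matched π f τ := by
  let S : Finset (α → α) := univ.filter (fun τ => (∀ a, τ (τ a) = a) ∧ (∀ a, π (τ a) = π a) ∧
    (∀ a, τ a ≠ a → f (τ a) = - f a))
  have hS : S.Nonempty := ⟨id, by simp [S]⟩
  obtain ⟨τ, hτ, hmin⟩ := Finset.exists_min_image S (fun τ => (univ.filter (fun a => τ a = a)).card) hS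
  simp only [S, mem_filter, mem_univ, true_and] at hτ hmin
  obtain ⟨h1, h2, h3⟩ := hτ
  refine ⟨τ, h1, h2, h3, ?_⟩
  intro x y hx hy hxy
  by_contra hne
  have hxne : x ≠ y := fun h => hne (by rw [h])
  have hfx : f y = - f x := by
    have h := hf x
    have h' := hf y
    omega
  let τ' : α → α := fun a => if a = x then y else if a = y then x else τ a
  have hτx : ∀ a, τ a = x → a = x := fun a ha => by rw [← h1 a, ha, hx]
  have hτy : ∀ a, τ a = y → a = y := fun a ha => by rw [← h1 a, ha, hy]
  have := hmin τ' ?_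
  · have hlt : (univ.filter (fun a => τ' a = a)).card < (univ.filter (fun a => τ a = a)).card := by
      apply Finset.card_lt_card
      rw [Finset.ssubset_iff_of_subset]
      · refine ⟨x, by simp [hx], ?_⟩
        simp [τ', hxne.symm]
      · intro a ha
        simp only [τ', mem_filter, mem_univ, true_and] at ha ⊢
        grind
    omega
  · refine ⟨?_, ?_, ?_⟩
    · intro a; simp only [τ']; grind
    · intro a; simp only [τ']; grind
    · intro a; simp only [τ']; grind

/-- Class relation: orbits glued at the unmatched darts of each vertex. -/
def crel {α V : Type*} (σ τ : α → α) (π : α → V) : Setoid α :=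
  EqvGen.setoid (fun x y => y = σ x ∨ y = τ x ∨ (τ x = x ∧ τ y = y ∧ π x = π y))

lemma crel_ind {α V : Type*} {σ τ : α → α} {π : α → V} (P : α → Prop)
    (hs : ∀ x, P x ↔ P (σ x)) (ht : ∀ x, P x ↔ P (τ x))
    (hp : ∀ x y, τ x = x → τ y = y → π x = π y → (P x ↔ P y)) {x y : α} (h : (crel σ τ π) x y) :
    P x ↔ P y := by
  induction h with
  | rel x y h => 
    rcases h with rfl | rfl | ⟨h1, h2, h3⟩
    exacts [hs x, ht x, hp x y h1 h2 h3]
  | refl x => rfl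
  | symm x y _ ih => exact ih.symm
  | trans x y z _ _ ih1 ih2 => exact ih1.trans ih2

lemma crel_s {α V : Type*} (σ τ : α → α) (π : α → V) (x : α) : (crel σ τ π) x (σ x) :=
  EqvGen.rel _ _ (Or.inl rfl)
lemma crel_t {α V : Type*} (σ τ : α → α) (π : α → V) (x : α) : (crel σ τ π) x (τ x) :=
  EqvGen.rel _ _ (Or.inr (Or.inl rfl))
lemma crel_p {α V : Type*} (σ τ : α → α) (π : α → V) {x y : α} (hx : τ x = x) (hy : τ y = y)
    (h : π x = π y) : (crel σ τ π) x y :=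
  EqvGen.rel _ _ (Or.inr (Or.inr ⟨hx, hy, h⟩))
lemma crel_of_orel {α V : Type*} (σ τ : α → α) (π : α → V) {x y : α} (h : (orel σ τ) x y) :
    (crel σ τ π) x y := by
  refine (orel_ind (fun z => (crel σ τ π) x z) ?_ ?_ h).1 ((crel σ τ π).refl x)
  · intro z
    exact ⟨fun h => (crel σ τ π).trans h (crel_s ..),
      fun h => (crel σ τ π).trans h ((crel σ τ π).symm (crel_s ..))⟩
  · intro z
    exact ⟨fun h => (crel σ τ π).trans h (crel_t ..),
      fun h => (crel σ τ π).trans h ((crel σ τ π).symm (crel_t ..))⟩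

/-- matched darts cancel in sums -/
lemma sum_matched {α : Type*} (S : Finset α) (τ : α → α) (h : α → ℤ)
    (hS : ∀ a ∈ S, τ a ∈ S) (hi : ∀ a, τ (τ a) = a) (ha : ∀ a ∈ S, τ a ≠ a → h (τ a) = - h a) :
    ∑ a ∈ S, h a = ∑ a ∈ S with τ a = a, h a := by
  rw [← Finset.sum_filter_add_sum_filter_not S (fun a => τ a = a) h]
  rw [add_eq_left]
  refine Finset.sum_involution (fun a _ => τ a) ?_ ?_ ?_ ?_
  · intro a h'; simp only [mem_filter] at h'; rw [ha a h'.1 h'.2]; ring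
  · intro a h' _; exact (mem_filter.1 h').2
  · intro a h'; simp only [mem_filter] at h' ⊢
    refine ⟨hS a h'.1, ?_⟩
    rw [hi]; exact fun h => h'.2 h.symm
  · intro a _; exact hi a

lemma even_card_matched {α : Type*} (S : Finset α) (τ : α → α)
    (hS : ∀ a ∈ S, τ a ∈ S) (hi : ∀ a, τ (τ a) = a) :
    Even S.card ↔ Even (S.filter (fun a => τ a = a)).card := by
  rw [← Finset.card_filter_add_card_filter_not (s := S) (fun a => τ a = a), Nat.even_add]
  have : Even (S.filter (fun a => ¬ τ a = a)).card := by
    refine even_card_invol _ τ ?_ (fun a _ => hi a) ?_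
    · intro a h'; simp only [mem_filter] at h' ⊢
      refine ⟨hS a h'.1, ?_⟩
      rw [hi]; exact fun h => h'.2 h.symm
    · intro a h'; exact (mem_filter.1 h').2
  tauto

/-- the crucial step: in a minimal flow every class has at most one surplus vertex, of surplus 6 -/
lemma class_small {α V : Type*} [Fintype α] [Fintype V] (σ : α → α) (π : α → V) (f : α → ℤ)
    (τ : α → α) (hs : ∀ x, σ (σ x) = x) (hs' : ∀ x, σ x ≠ x)
    (hev : ∀ v, Even (univ.filter (fun a => π a = v)).card)
    (hf : FlowData σ π f) (hτ : Matched π f τ)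
    (hmin : ∀ g, FlowData σ π g →
      ∑ v, |∑ a with π a = v, f a| ≤ ∑ v, |∑ a with π a = v, g a|)
    (d : α) (hd : τ d = d) :
    (∀ x, τ x = x → (crel σ τ π) d x → π x = π d) ∧
    (univ.filter (fun x => π x = π d ∧ τ x = x)).card = 6 := by
  set Fx : V → Finset α := fun v => univ.filter (fun x => π x = v ∧ τ x = x) with hFx
  have hsum : ∀ (g : α → ℤ), (∀ a, τ a ≠ a → g (τ a) = - g a) → ∀ v,
      ∑ a with π a = v, g a = ∑ a ∈ Fx v, g a := by
    intro g hg v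
    rw [sum_matched _ τ g ?_ hτ.invol (fun a _ => hg a), Finset.filter_filter]
    intro a ha
    simp only [mem_filter, mem_univ, true_and] at ha ⊢
    rw [hτ.pi, ha]
  have hc : ∀ v, ∃ c : ℤ, (c = 1 ∨ c = -1) ∧ ∀ a ∈ Fx v, f a = c := by
    intro v
    rcases (Fx v).eq_empty_or_nonempty with h | ⟨b, hb⟩
    · exact ⟨1, Or.inl rfl, by simp [h]⟩
    · refine ⟨f b, hf.pm b, ?_⟩
      intro a ha
      simp only [hFx, mem_filter, mem_univ, true_and] at ha hb
      exact hτ.fix a b ha.2 hb.2 (ha.1.trans hb.1.symm)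
  choose c hc1 hc2 using hc
  have hsf : ∀ v, ∑ a with π a = v, f a = c v * (Fx v).card := by
    intro v
    rw [hsum f hτ.anti v, Finset.sum_congr rfl (hc2 v), Finset.sum_const, nsmul_eq_mul, mul_comm]
  have h6 : ∀ v, 6 ∣ (Fx v).card := by
    intro v
    have h3 : (3 : ℤ) ∣ (Fx v).card := by
      have := hf.div v
      rw [hsf] at this
      rcases hc1 v with h | h <;> rw [h] at this <;> simpa using this
    have h2 : Even (Fx v).card := by
      have := (even_card_matched (univ.filter (fun a => π a = v)) τ ?_ hτ.invol).1 (hev v)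
      · rwa [Finset.filter_filter] at this
      · intro a ha
        simp only [mem_filter, mem_univ, true_and] at ha ⊢
        rw [hτ.pi, ha]
    obtain ⟨k, hk⟩ := h2
    omega
  set FQ := univ.filter (fun x => τ x = x ∧ (crel σ τ π) d x) with hFQ
  set VQ := FQ.image π with hVQ
  let orb : α → Quotient (orel σ τ) := fun x => Quotient.mk _ x
  have horb : ∀ x y, orb x = orb y ↔ (orel σ τ) x y := fun x y => Quotient.eq
  set OQ := FQ.image orb with hOQ
  have hdFQ : d ∈ FQ := by simp [hFQ, hd]
  have hOcard : FQ.card = OQ.card * 2 := by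
    refine Finset.card_eq_sum_card_image orb FQ |>.trans ?_
    refine (Finset.sum_const_nat ?_)
    intro o ho
    obtain ⟨x, hx, rfl⟩ := Finset.mem_image.1 ho
    simp only [hFQ, mem_filter, mem_univ, true_and] at hx
    have := orbit_two σ τ hs hs' hτ.invol x hx.1
    rw [← this]
    congr 1
    ext y
    simp only [hFQ, mem_filter, mem_univ, true_and, horb]
    constructor
    · rintro ⟨⟨h1, h2⟩, h3⟩; exact ⟨(orel σ τ).symm h3, h1⟩
    · rintro ⟨h1, h2⟩
      exact ⟨⟨h2, (crel σ τ π).trans hx.2 (crel_of_orel σ τ π h1)⟩, (orel σ τ).symm h1⟩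
  have hFxQ : ∀ v ∈ VQ, ∀ x, x ∈ Fx v ↔ x ∈ FQ ∧ π x = v := by
    intro v hv x
    obtain ⟨y, hy, rfl⟩ := Finset.mem_image.1 hv
    simp only [hFQ, hFx, mem_filter, mem_univ, true_and] at hy ⊢
    constructor
    · rintro ⟨h1, h2⟩
      exact ⟨⟨h2, (crel σ τ π).trans hy.2 (crel_p σ τ π hy.1 h2 h1.symm)⟩, h1⟩
    · rintro ⟨⟨h1, h2⟩, h3⟩; exact ⟨h3, h1⟩
  have hVcard : FQ.card = ∑ v ∈ VQ, (Fx v).card := by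
    refine (Finset.card_eq_sum_card_image π FQ).trans ?_
    refine Finset.sum_congr rfl (fun v hv => ?_)
    congr 1
    ext x
    rw [hFxQ v hv, mem_filter]
  have hge : ∀ v ∈ VQ, 6 ≤ (Fx v).card := by
    intro v hv
    obtain ⟨y, hy, rfl⟩ := Finset.mem_image.1 hv
    refine Nat.le_of_dvd (Finset.card_pos.2 ⟨y, (hFxQ _ hv y).2 ⟨hy, rfl⟩⟩) (h6 _)
  have hcw : OQ.card ≤ 1 + 2 * VQ.card := by
    by_contra hlt
    push Not at hlt
    let o0 : {o // o ∈ OQ} := ⟨orb d, Finset.mem_image_of_mem _ hdFQ⟩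
    let g : α → {o // o ∈ OQ} := fun x => if h : orb x ∈ OQ then ⟨orb x, h⟩ else o0
    let P : Option V → MvPolynomial {o // o ∈ OQ} (ZMod 3) := fun i =>
      match i with
      | none => MvPolynomial.X o0
      | some v => ∑ a ∈ Fx v, (MvPolynomial.X (g a)) ^ 2
    have hdeg : ∑ i ∈ insert none (VQ.image some), (P i).totalDegree
        < Fintype.card {o // o ∈ OQ} := by
      rw [Finset.sum_insert (by simp), Finset.sum_image (by simp)]
      rw [Fintype.card_coe]
      refine lt_of_le_of_lt ?_ hlt
      have e1 : (P none).totalDegree ≤ 1 := by simp [P]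
      have e2 : ∀ v ∈ VQ, (P (some v)).totalDegree ≤ 2 := by
        intro v _
        refine MvPolynomial.totalDegree_finsetSum_le ?_
        intro a _
        refine (MvPolynomial.totalDegree_pow _ _).trans ?_
        simp
      have := Finset.sum_le_card_nsmul VQ _ 2 e2
      simp only [smul_eq_mul] at this
      omega
    have hdvd := char_dvd_card_solutions_of_sum_lt 3 hdeg
    have : ∃ x : {o // o ∈ OQ} → ZMod 3, (∀ i ∈ insert none (VQ.image some), MvPolynomial.eval x (P i) = 0) ∧ x ≠ 0 := by
      by_contra hno
      push Not at hno
      have h1 : Fintype.card { x : {o // o ∈ OQ} → ZMod 3 // ∀ i ∈ insert none (VQ.image some), MvPolynomial.eval x (P i) = 0 } = 1 := by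
        rw [Fintype.card_eq_one_iff]
        refine ⟨⟨0, ?_⟩, ?_⟩
        · intro i _
          cases i <;> simp [P]
        · rintro ⟨y, hy⟩
          exact Subtype.ext (hno y hy)
      have h13 : 3 ∣ 1 := by
        refine hdvd.trans (dvd_of_eq (Eq.trans ?_ h1))
        congr!
      omega
    obtain ⟨x, hx, hx0⟩ := this
    have hxo : x o0 = 0 := by simpa [P] using hx none (by simp)
    have hxv : ∀ v ∈ VQ, ∑ a ∈ Fx v, (x (g a)) ^ 2 = 0 := by
      intro v hv
      simpa [P] using hx (some v) (by simp [hv])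
    let χ : α → Prop := fun a => x (g a) ≠ 0
    have hgo : ∀ a b, orb a = orb b → g a = g b := by
      intro a b hab; simp only [g, hab]
    have hχs : ∀ a, χ a ↔ χ (σ a) := by
      intro a; simp only [χ]
      rw [hgo a (σ a) ((horb _ _).2 (orel_s σ τ a))]
    have hχt : ∀ a, χ a ↔ χ (τ a) := by
      intro a; simp only [χ]
      rw [hgo a (τ a) ((horb _ _).2 (orel_t σ τ a))]
    let f' : α → ℤ := fun a => if χ a then - f a else f a
    have hf's : ∀ v, ∑ a with π a = v, f' a
        = c v * ((Fx v).card - 2 * ((Fx v).filter χ).card) := by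
      intro v
      rw [hsum f' ?_ v]
      · have : ∀ a ∈ Fx v, f' a = c v - (if χ a then 2 * c v else 0) := by
          intro a ha
          simp only [f', hc2 v a ha]
          split_ifs <;> ring
        rw [Finset.sum_congr rfl this, Finset.sum_sub_distrib, ← Finset.sum_filter]
        simp only [Finset.sum_const, nsmul_eq_mul]
        ring
      · intro a ha
        simp only [f', ← hχt a, hτ.anti a ha]
        split_ifs <;> rfl
    have h3m : ∀ v, 3 ∣ ((Fx v).filter χ).card := by
      intro v
      by_cases hv : v ∈ VQ
      · have h1 := hxv v hv
        have h2 : ∀ z : ZMod 3, z ^ 2 = if z ≠ 0 then 1 else 0 := by decide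
        rw [Finset.sum_congr rfl (fun a _ => h2 _), ← Finset.sum_filter, Finset.sum_const,
          nsmul_eq_mul, mul_one] at h1
        exact (ZMod.natCast_eq_zero_iff _ _).1 h1
      · have : (Fx v).filter χ = ∅ := by
          rw [Finset.filter_eq_empty_iff]
          intro a ha hχ
          apply hχ
          have : orb a ∉ OQ := by
            intro hmem
            obtain ⟨b, hb, hab⟩ := Finset.mem_image.1 hmem
            apply hv
            simp only [hFx, mem_filter, mem_univ, true_and] at ha
            simp only [hFQ, mem_filter, mem_univ, true_and] at hb
            refine Finset.mem_image.2 ⟨a, ?_, ha.1⟩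
            simp only [hFQ, mem_filter, mem_univ, true_and]
            exact ⟨ha.2, (crel σ τ π).trans hb.2 (crel_of_orel σ τ π ((horb _ _).1 hab))⟩
          simp only [g, this, dif_neg, not_false_eq_true]
          exact hxo
        simp [this]
    have hF' : FlowData σ π f' := by
      refine ⟨?_, ?_, ?_⟩
      · intro a; simp only [f']
        rcases hf.pm a with h | h <;> split_ifs <;> simp [h]
      · intro a; simp only [f', ← hχs a, hf.inv]
      · intro v
        rw [hf's]
        apply Dvd.dvd.mul_left
        have a1 := h6 v
        have a2 := h3m v
        omega
    have habs : ∀ v, |∑ a with π a = v, f' a| ≤ |∑ a with π a = v, f a| ∧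
        (|∑ a with π a = v, f' a| = |∑ a with π a = v, f a| →
          ((Fx v).filter χ).card = 0 ∨ ((Fx v).filter χ).card = (Fx v).card) := by
      intro v
      have hle := Finset.card_filter_le (Fx v) χ
      rw [hf's, hsf, abs_mul, abs_mul]
      have : |c v| = 1 := by rcases hc1 v with h | h <;> simp [h]
      rw [this, one_mul, one_mul]
      generalize ((Fx v).filter χ).card = m at *
      generalize (Fx v).card = n at *
      constructor
      · rw [abs_le, Nat.abs_cast]; omega
      · rw [Nat.abs_cast]; intro h
        rcases abs_eq (by positivity) |>.1 h with h | h <;> omega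
    have heq : ∀ v, |∑ a with π a = v, f' a| = |∑ a with π a = v, f a| := by
      have := (Finset.sum_eq_sum_iff_of_le (fun v (_ : v ∈ (univ : Finset V)) => (habs v).1)).1
        (le_antisymm (Finset.sum_le_sum (fun v _ => (habs v).1)) (hmin f' hF'))
      exact fun v => this v (mem_univ v)
    have hconst : ∀ a b, τ a = a → τ b = b → π a = π b → (χ a ↔ χ b) := by
      intro a b ha hb hab
      have haF : a ∈ Fx (π a) := by simp [hFx, ha]
      have hbF : b ∈ Fx (π a) := by simp [hFx, hb, hab]
      rcases (habs (π a)).2 (heq (π a)) with h | h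
      · rw [Finset.card_eq_zero, Finset.filter_eq_empty_iff] at h
        simp [h haF, h hbF]
      · have := Finset.card_filter_eq_iff.1 h
        simp [this a haF, this b hbF]
    have hfin : ∀ a, (crel σ τ π) d a → ¬ χ a := by
      intro a ha
      rw [← crel_ind χ hχs hχt hconst ha]
      simp only [χ, not_not]
      have : g d = o0 := by simp only [g, o0]; split_ifs <;> rfl
      rw [this, hxo]
    apply hx0
    funext o
    obtain ⟨o, ho⟩ := o
    obtain ⟨a, ha, rfl⟩ := Finset.mem_image.1 ho
    have h1 : g a = ⟨orb a, ho⟩ := by simp only [g, ho, dif_pos]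
    have h2 := hfin a (mem_filter.1 ha).2.2
    simp only [χ, not_not, h1] at h2
    exact h2
  have hVpos : 0 < VQ.card := Finset.card_pos.2 ⟨π d, Finset.mem_image_of_mem _ hdFQ⟩
  have hlow := Finset.card_nsmul_le_sum VQ _ 6 hge
  simp only [smul_eq_mul] at hlow
  have hV1 : VQ.card = 1 := by omega
  obtain ⟨v, hv⟩ := Finset.card_eq_one.1 hV1
  have hvd : π d = v := by
    have : π d ∈ VQ := Finset.mem_image_of_mem _ hdFQ
    rw [hv] at this; simpa using this
  constructor
  · intro x hx hx'
    have : π x ∈ VQ := Finset.mem_image_of_mem _ (by simp only [hFQ, mem_filter, mem_univ, true_and]; exact ⟨hx, hx'⟩)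
    rw [hv] at this
    rw [hvd]; simpa using this
  · change (Fx (π d)).card = 6
    rw [hv, Finset.sum_singleton] at hVcard
    have := hge v (by simp [hv])
    rw [hvd]
    omega

end

section
open scoped Classical

/-- A connected even set of darts. -/
structure Piece {α V : Type*} (σ : α → α) (π : α → V) (S : Finset α) : Prop where
  ne : S.Nonempty
  cl : ∀ a ∈ S, σ a ∈ S
  ev : ∀ v, Even (S.filter (fun a => π a = v)).card
  conn : ∀ P : α → Prop, (∀ x ∈ S, P x → P (σ x)) →
    (∀ x ∈ S, ∀ y ∈ S, π x = π y → P x → P y) → ∀ a ∈ S, ∀ b ∈ S, P a → P b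

/-- A rooted 3-odd decomposition of a dart set. -/
def RDec {α V : Type*} (σ : α → α) (π : α → V) (U : Finset α) : Prop :=
  ∃ D : Fin 3 → Finset α, (∀ i, Piece σ π (D i)) ∧ (∀ i, (D i).card % 4 = 2) ∧
    (∀ i j, i ≠ j → Disjoint (D i) (D j)) ∧ (∀ a, a ∈ U ↔ ∃ i, a ∈ D i) ∧
    ∃ v, ∀ i, ∃ a ∈ D i, π a = v

lemma piece_union {α V : Type*} {σ : α → α} {π : α → V} {S T : Finset α}
    (hS : Piece σ π S) (hT : Piece σ π T) (hd : Disjoint S T)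
    (h : ∃ s ∈ S, ∃ t ∈ T, π s = π t) : Piece σ π (S ∪ T) := by
  obtain ⟨s, hs, t, ht, hst⟩ := h
  refine ⟨hS.ne.mono subset_union_left, ?_, ?_, ?_⟩
  · intro a ha
    rcases mem_union.1 ha with h | h
    · exact mem_union_left _ (hS.cl a h)
    · exact mem_union_right _ (hT.cl a h)
  · intro v
    rw [Finset.filter_union, Finset.card_union_of_disjoint]
    · exact (hS.ev v).add (hT.ev v)
    · exact Finset.disjoint_filter_filter hd
  · intro P h1 h2 a ha b hb hP
    have cS := hS.conn P (fun x hx => h1 x (mem_union_left _ hx))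
      (fun x hx y hy => h2 x (mem_union_left _ hx) y (mem_union_left _ hy))
    have cT := hT.conn P (fun x hx => h1 x (mem_union_right _ hx))
      (fun x hx y hy => h2 x (mem_union_right _ hx) y (mem_union_right _ hy))
    have e1 : P s ↔ P t := ⟨h2 s (mem_union_left _ hs) t (mem_union_right _ ht) hst,
      h2 t (mem_union_right _ ht) s (mem_union_left _ hs) hst.symm⟩
    have hPs : P s := by
      rcases mem_union.1 ha with h | h
      · exact cS a h s hs hP
      · exact e1.2 (cT a h t ht hP)
    rcases mem_union.1 hb with h | h
    · exact cS s hs b h hPs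
    · exact cT t ht b h (e1.1 hPs)

lemma attach {α V : Type*} {σ : α → α} {π : α → V} {U W : Finset α}
    (hU : RDec σ π U) (hW : Piece σ π W) (hc : W.card % 4 = 0) (hd : Disjoint U W)
    (h : ∃ s ∈ U, ∃ t ∈ W, π s = π t) : RDec σ π (U ∪ W) := by
  obtain ⟨D, h1, h2, h3, h4, v, h5⟩ := hU
  obtain ⟨s, hs, t, ht, hst⟩ := h
  obtain ⟨i, hi⟩ := (h4 s).1 hs
  have hdW : ∀ j, Disjoint (D j) W := fun j =>
    Finset.disjoint_of_subset_left (fun a ha => (h4 a).2 ⟨j, ha⟩) hd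
  have key : ∀ j, Function.update D i (D i ∪ W) j = if j = i then D i ∪ W else D j := by
    intro j; simp only [Function.update_apply]
  refine ⟨Function.update D i (D i ∪ W), ?_, ?_, ?_, ?_, v, ?_⟩
  · intro j
    rw [key]; split_ifs with hj
    · exact piece_union (h1 i) hW (hdW i) ⟨s, hi, t, ht, hst⟩
    · exact h1 j
  · intro j
    rw [key]; split_ifs with hj
    · rw [Finset.card_union_of_disjoint (hdW i)]
      have := h2 i
      omega
    · exact h2 j
  · intro j k hjk
    rw [key, key]
    split_ifs with hj hk hk
    · exact absurd (hj.trans hk.symm) hjk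
    · rw [Finset.disjoint_union_left]
      exact ⟨h3 _ _ (fun h => hk h.symm), (hdW k).symm⟩
    · rw [Finset.disjoint_union_right]
      exact ⟨h3 _ _ hj, hdW j⟩
    · exact h3 _ _ hjk
  · intro a
    rw [mem_union, h4]
    constructor
    · rintro (⟨j, hj⟩ | h)
      · refine ⟨j, ?_⟩
        rw [key]; split_ifs with hji
        · subst hji; exact mem_union_left _ hj
        · exact hj
      · exact ⟨i, by rw [key, if_pos rfl]; exact mem_union_right _ h⟩
    · rintro ⟨j, hj⟩
      rw [key] at hj
      split_ifs at hj with hji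
      · rcases mem_union.1 hj with h | h
        · exact Or.inl ⟨i, h⟩
        · exact Or.inr h
      · exact Or.inl ⟨j, hj⟩
  · intro j
    obtain ⟨a, ha, hav⟩ := h5 j
    refine ⟨a, ?_, hav⟩
    rw [key]; split_ifs with hji
    · subst hji; exact mem_union_left _ ha
    · exact ha

lemma card_mod4 {α : Type*} (σ : α → α) (f : α → ℤ) (hs : ∀ x, σ (σ x) = x) (hs' : ∀ x, σ x ≠ x)
    (pm : ∀ a, f a = 1 ∨ f a = -1) (inv : ∀ a, f (σ a) = f a) (S : Finset α)
    (hS : ∀ a ∈ S, σ a ∈ S) : (4 : ℤ) ∣ S.card - ∑ a ∈ S, f a := by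
  have h1 : ∀ a ∈ S, f a = 1 - (if f a = -1 then 2 else 0) := by
    intro a _
    rcases pm a with h | h <;> simp [h]
  rw [Finset.sum_congr rfl h1, Finset.sum_sub_distrib, ← Finset.sum_filter]
  simp only [Finset.sum_const, nsmul_eq_mul]
  have : Even (S.filter (fun a => f a = -1)).card := by
    refine even_card_invol _ σ ?_ (fun a _ => hs a) (fun a _ => hs' a)
    intro a ha
    simp only [mem_filter] at ha ⊢
    exact ⟨hS a ha.1, by rw [inv, ha.2]⟩
  obtain ⟨k, hk⟩ := this
  rw [hk]; push_cast
  exact ⟨k, by ring⟩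

lemma class_piece {α V : Type*} [Fintype α] [Fintype V] (σ : α → α) (π : α → V) (f : α → ℤ)
    (τ : α → α) (hs : ∀ x, σ (σ x) = x) (hs' : ∀ x, σ x ≠ x)
    (hev : ∀ v, Even (univ.filter (fun a => π a = v)).card)
    (hτ : Matched π f τ) (d : α) :
    Piece σ π (univ.filter (fun x => (crel σ τ π) d x)) := by
  have hms : ∀ x, x ∈ univ.filter (fun x => (crel σ τ π) d x) ↔ (crel σ τ π) d x := by simp
  have hsx : ∀ x, (crel σ τ π) d x ↔ (crel σ τ π) d (σ x) := fun x =>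
    ⟨fun h => (crel σ τ π).trans h (crel_s ..),
      fun h => (crel σ τ π).trans h ((crel σ τ π).symm (crel_s ..))⟩
  have htx : ∀ x, (crel σ τ π) d x ↔ (crel σ τ π) d (τ x) := fun x =>
    ⟨fun h => (crel σ τ π).trans h (crel_t ..),
      fun h => (crel σ τ π).trans h ((crel σ τ π).symm (crel_t ..))⟩
  refine ⟨⟨d, (hms d).2 ((crel σ τ π).refl d)⟩, ?_, ?_, ?_⟩
  · intro a ha
    rw [hms] at ha ⊢
    exact (hsx a).1 ha
  · intro v
    rw [even_card_matched _ τ ?_ hτ.invol]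
    · by_cases hex : ∃ x, (crel σ τ π) d x ∧ τ x = x ∧ π x = v
      · obtain ⟨x, hx, hxt, rfl⟩ := hex
        have h1 := (even_card_matched (univ.filter (fun a => π a = π x)) τ ?_ hτ.invol).1 (hev (π x))
        · convert h1 using 2
          ext a
          simp only [mem_filter, mem_univ, true_and]
          constructor
          · rintro ⟨⟨_, h⟩, h'⟩; exact ⟨h, h'⟩
          · rintro ⟨h, h'⟩
            exact ⟨⟨(crel σ τ π).trans hx (crel_p σ τ π hxt h' h.symm), h⟩, h'⟩
        · intro a ha
          simp only [mem_filter, mem_univ, true_and] at ha ⊢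
          rw [hτ.pi, ha]
      · have : (((univ.filter (fun x => (crel σ τ π) d x)).filter (fun a => π a = v)).filter
            (fun a => τ a = a)) = ∅ := by
          ext a
          simp only [mem_filter, mem_univ, true_and, notMem_empty, iff_false]
          rintro ⟨⟨h1, h2⟩, h3⟩
          exact hex ⟨a, h1, h3, h2⟩
        rw [this]; simp
    · intro a ha
      simp only [mem_filter, mem_univ, true_and] at ha ⊢
      exact ⟨(htx a).1 ha.1, by rw [hτ.pi, ha.2]⟩
  · intro P h1 h2 a ha b hb hP
    rw [hms] at ha hb
    have := (crel_ind (fun x => (crel σ τ π) d x ∧ P x) ?_ ?_ ?_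
      ((crel σ τ π).trans ((crel σ τ π).symm ha) hb)).1 ⟨ha, hP⟩
    · exact this.2
    · intro x
      constructor
      · rintro ⟨h, h'⟩
        exact ⟨(hsx x).1 h, h1 x ((hms x).2 h) h'⟩
      · rintro ⟨h, h'⟩
        refine ⟨(hsx x).2 h, ?_⟩
        have := h1 (σ x) ((hms _).2 h) h'
        rwa [hs] at this
    · intro x
      constructor
      · rintro ⟨h, h'⟩
        exact ⟨(htx x).1 h, h2 x ((hms _).2 h) (τ x) ((hms _).2 ((htx x).1 h)) (hτ.pi x).symm h'⟩
      · rintro ⟨h, h'⟩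
        exact ⟨(htx x).2 h, h2 (τ x) ((hms _).2 h) x ((hms _).2 ((htx x).2 h)) (hτ.pi x) h'⟩
    · intro x y hx hy hxy
      constructor
      · rintro ⟨h, h'⟩
        have hy' := (crel σ τ π).trans h (crel_p σ τ π hx hy hxy)
        exact ⟨hy', h2 x ((hms _).2 h) y ((hms _).2 hy') hxy h'⟩
      · rintro ⟨h, h'⟩
        have hy' := (crel σ τ π).trans h (crel_p σ τ π hy hx hxy.symm)
        exact ⟨hy', h2 y ((hms _).2 h) x ((hms _).2 hy') hxy.symm h'⟩

lemma orbit_piece {α V : Type*} [Fintype α] [Fintype V] (σ : α → α) (π : α → V) (f : α → ℤ)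
    (τ : α → α) (hs : ∀ x, σ (σ x) = x) (hs' : ∀ x, σ x ≠ x)
    (pm : ∀ a, f a = 1 ∨ f a = -1) (inv : ∀ a, f (σ a) = f a)
    (hτ : Matched π f τ) (d : α) (hd : τ d = d)
    (hv : ∀ x, τ x = x → (orel σ τ) d x → π x = π d) :
    Piece σ π (univ.filter (fun x => (orel σ τ) d x)) ∧
    (univ.filter (fun x => (orel σ τ) d x)).card % 4 = 2 := by
  have hms : ∀ x, x ∈ univ.filter (fun x => (orel σ τ) d x) ↔ (orel σ τ) d x := by simp
  have hsx : ∀ x, (orel σ τ) d x ↔ (orel σ τ) d (σ x) := fun x =>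
    ⟨fun h => (orel σ τ).trans h (orel_s ..),
      fun h => (orel σ τ).trans h ((orel σ τ).symm (orel_s ..))⟩
  have htx : ∀ x, (orel σ τ) d x ↔ (orel σ τ) d (τ x) := fun x =>
    ⟨fun h => (orel σ τ).trans h (orel_t ..),
      fun h => (orel σ τ).trans h ((orel σ τ).symm (orel_t ..))⟩
  have htwo := orbit_two σ τ hs hs' hτ.invol d hd
  have hcl : ∀ a ∈ univ.filter (fun x => (orel σ τ) d x),
      σ a ∈ univ.filter (fun x => (orel σ τ) d x) := by
    intro a ha
    rw [hms] at ha ⊢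
    exact (hsx a).1 ha
  refine ⟨⟨⟨d, (hms d).2 ((orel σ τ).refl d)⟩, hcl, ?_, ?_⟩, ?_⟩
  · intro v
    rw [even_card_matched _ τ ?_ hτ.invol]
    · by_cases hvd : v = π d
      · have : (((univ.filter (fun x => (orel σ τ) d x)).filter (fun a => π a = v)).filter
            (fun a => τ a = a)) = univ.filter (fun x => (orel σ τ) d x ∧ τ x = x) := by
          ext a
          simp only [mem_filter, mem_univ, true_and]
          constructor
          · rintro ⟨⟨h, _⟩, h'⟩; exact ⟨h, h'⟩
          · rintro ⟨h, h'⟩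
            exact ⟨⟨h, by rw [hvd]; exact hv a h' h⟩, h'⟩
        rw [this, htwo]; decide
      · have : (((univ.filter (fun x => (orel σ τ) d x)).filter (fun a => π a = v)).filter
            (fun a => τ a = a)) = ∅ := by
          ext a
          simp only [mem_filter, mem_univ, true_and, notMem_empty, iff_false]
          rintro ⟨⟨h1, h2⟩, h3⟩
          exact hvd (by rw [← h2]; exact hv a h3 h1)
        rw [this]; simp
    · intro a ha
      simp only [mem_filter, mem_univ, true_and] at ha ⊢
      exact ⟨(htx a).1 ha.1, by rw [hτ.pi, ha.2]⟩
  · intro P h1 h2 a ha b hb hP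
    rw [hms] at ha hb
    have := (orel_ind (fun x => (orel σ τ) d x ∧ P x) ?_ ?_
      ((orel σ τ).trans ((orel σ τ).symm ha) hb)).1 ⟨ha, hP⟩
    · exact this.2
    · intro x
      constructor
      · rintro ⟨h, h'⟩
        exact ⟨(hsx x).1 h, h1 x ((hms x).2 h) h'⟩
      · rintro ⟨h, h'⟩
        refine ⟨(hsx x).2 h, ?_⟩
        have := h1 (σ x) ((hms _).2 h) h'
        rwa [hs] at this
    · intro x
      constructor
      · rintro ⟨h, h'⟩
        exact ⟨(htx x).1 h, h2 x ((hms _).2 h) (τ x) ((hms _).2 ((htx x).1 h)) (hτ.pi x).symm h'⟩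
      · rintro ⟨h, h'⟩
        exact ⟨(htx x).2 h, h2 (τ x) ((hms _).2 h) x ((hms _).2 ((htx x).2 h)) (hτ.pi x) h'⟩
  · have h4 := card_mod4 σ f hs hs' pm inv _ hcl
    rw [sum_matched _ τ f ?_ hτ.invol (fun a _ => hτ.anti a), Finset.filter_filter] at h4
    · have : ∀ a ∈ univ.filter (fun x => (orel σ τ) d x ∧ τ x = x), f a = f d := by
        intro a ha
        simp only [mem_filter, mem_univ, true_and] at ha
        exact hτ.fix a d ha.2 hd (hv a ha.2 ha.1)
      rw [Finset.sum_congr rfl this, Finset.sum_const, htwo, nsmul_eq_mul] at h4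
      have := pm d
      push_cast at h4
      omega
    · intro a ha
      simp only [mem_filter, mem_univ, true_and] at ha ⊢
      exact (htx a).1 ha

lemma class_dec {α V : Type*} [Fintype α] [Fintype V] (σ : α → α) (π : α → V) (f : α → ℤ)
    (τ : α → α) (hs : ∀ x, σ (σ x) = x) (hs' : ∀ x, σ x ≠ x)
    (pm : ∀ a, f a = 1 ∨ f a = -1) (inv : ∀ a, f (σ a) = f a) (hτ : Matched π f τ)
    (hsm : ∀ d, τ d = d → (∀ x, τ x = x → (crel σ τ π) d x → π x = π d) ∧
      (univ.filter (fun x => π x = π d ∧ τ x = x)).card = 6)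
    (d0 : α) (hodd : (univ.filter (fun x => (crel σ τ π) d0 x)).card % 4 = 2) :
    RDec σ π (univ.filter (fun x => (crel σ τ π) d0 x)) := by
  have hex : ∃ d, (crel σ τ π) d0 d ∧ τ d = d := by
    by_contra hno
    push Not at hno
    have h4 := card_mod4 σ f hs hs' pm inv (univ.filter (fun x => (crel σ τ π) d0 x)) ?_
    · rw [sum_matched _ τ f ?_ hτ.invol (fun a _ => hτ.anti a), Finset.filter_filter] at h4
      · have : univ.filter (fun x => (crel σ τ π) d0 x ∧ τ x = x) = ∅ := by
          ext a
          simp only [mem_filter, mem_univ, true_and, notMem_empty, iff_false]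
          rintro ⟨h1, h2⟩
          exact hno a h1 h2
        rw [this, Finset.sum_empty] at h4
        omega
      · intro a ha
        simp only [mem_filter, mem_univ, true_and] at ha ⊢
        exact (crel σ τ π).trans ha (crel_t ..)
    · intro a ha
      simp only [mem_filter, mem_univ, true_and] at ha ⊢
      exact (crel σ τ π).trans ha (crel_s ..)
  obtain ⟨d, hd0, hd⟩ := hex
  obtain ⟨hv, h6⟩ := hsm d hd
  set F := univ.filter (fun x => π x = π d ∧ τ x = x) with hF
  let orb : α → Quotient (orel σ τ) := fun x => Quotient.mk _ x
  have horb : ∀ x y, orb x = orb y ↔ (orel σ τ) x y := fun x y => Quotient.eq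
  have hFm : ∀ x, x ∈ F ↔ π x = π d ∧ τ x = x := by simp [hF]
  have hFc : ∀ x ∈ F, (crel σ τ π) d x := fun x hx =>
    crel_p σ τ π hd ((hFm x).1 hx).2 ((hFm x).1 hx).1.symm
  have hvo : ∀ z ∈ F, ∀ x, τ x = x → (orel σ τ) z x → π x = π z := by
    intro z hz x hx hzx
    rw [((hFm z).1 hz).1]
    exact hv x hx ((crel σ τ π).trans (hFc z hz) (crel_of_orel σ τ π hzx))
  have hOcard : F.card = (F.image orb).card * 2 := by
    refine Finset.card_eq_sum_card_image orb F |>.trans ?_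
    refine (Finset.sum_const_nat ?_)
    intro o ho
    obtain ⟨x, hx, rfl⟩ := Finset.mem_image.1 ho
    have := orbit_two σ τ hs hs' hτ.invol x ((hFm x).1 hx).2
    rw [← this]
    congr 1
    ext y
    simp only [mem_filter, mem_univ, true_and, horb]
    constructor
    · rintro ⟨h1, h3⟩; exact ⟨(orel σ τ).symm h3, ((hFm y).1 h1).2⟩
    · rintro ⟨h1, h2⟩
      refine ⟨(hFm y).2 ⟨?_, h2⟩, (orel σ τ).symm h1⟩
      rw [hvo x hx y h2 h1, ((hFm x).1 hx).1]
  have h3 : (F.image orb).card = 3 := by omega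
  let e : Fin 3 ≃ {o // o ∈ F.image orb} := ((F.image orb).equivFinOfCardEq h3).symm
  have hz : ∀ i, ∃ z ∈ F, orb z = (e i).1 := fun i => Finset.mem_image.1 (e i).2
  choose z hzF hze using hz
  have hpc := fun i => orbit_piece σ π f τ hs hs' pm inv hτ (z i) ((hFm _).1 (hzF i)).2 (hvo _ (hzF i))
  refine ⟨fun i => univ.filter (fun x => (orel σ τ) (z i) x), fun i => (hpc i).1,
    fun i => (hpc i).2, ?_, ?_, π d, ?_⟩
  · intro i j hij
    rw [Finset.disjoint_left]
    intro a hi hj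
    simp only [mem_filter, mem_univ, true_and] at hi hj
    apply hij
    apply e.injective
    apply Subtype.ext
    rw [← hze, ← hze, horb]
    exact (orel σ τ).trans hi ((orel σ τ).symm hj)
  · intro a
    simp only [mem_filter, mem_univ, true_and]
    constructor
    · intro ha
      have hda := (crel σ τ π).trans ((crel σ τ π).symm hd0) ha
      have : orb a ∈ F.image orb := by
        refine (crel_ind (fun x => orb x ∈ F.image orb) ?_ ?_ ?_ hda).1
          (Finset.mem_image_of_mem _ ((hFm d).2 ⟨rfl, hd⟩))
        · intro x; rw [(horb x (σ x)).2 (orel_s ..)]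
        · intro x; rw [(horb x (τ x)).2 (orel_t ..)]
        · have : ∀ x y, τ x = x → τ y = y → π x = π y → orb x ∈ F.image orb →
              orb y ∈ F.image orb := by
            intro x y hx hy hxy h
            obtain ⟨w, hw, hwx⟩ := Finset.mem_image.1 h
            apply Finset.mem_image_of_mem
            rw [hFm, ← hxy, hvo w hw x hx ((horb _ _).1 hwx)]
            exact ⟨((hFm w).1 hw).1, hy⟩
          exact fun x y hx hy hxy => ⟨this x y hx hy hxy, this y x hy hx hxy.symm⟩
      refine ⟨e.symm ⟨orb a, this⟩, ?_⟩
      rw [← horb, hze]; simp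
    · rintro ⟨i, hi⟩
      exact (crel σ τ π).trans hd0 ((crel σ τ π).trans (hFc _ (hzF i)) (crel_of_orel σ τ π hi))
  · intro i
    exact ⟨z i, by simp, ((hFm _).1 (hzF i)).1⟩

/-- abstract form of the flow to decomposition direction -/
theorem dart_main {α V : Type*} [Fintype α] [Nonempty α] [Fintype V] (σ : α → α) (π : α → V)
    (f : α → ℤ) (hs : ∀ x, σ (σ x) = x) (hs' : ∀ x, σ x ≠ x)
    (hev : ∀ v, Even (univ.filter (fun a => π a = v)).card)
    (hf : FlowData σ π f)
    (hconn : ∀ P : α → Prop, (∀ x, P x → P (σ x)) →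
      (∀ x y, π x = π y → P x → P y) → ∀ a b, P a → P b)
    (hodd : Fintype.card α % 4 = 2) : RDec σ π univ := by
  have hmin : ∃ f, FlowData σ π f ∧ ∀ g, FlowData σ π g →
      ∑ v, |∑ a with π a = v, f a| ≤ ∑ v, |∑ a with π a = v, g a| := by
    obtain ⟨g, hg⟩ := exists_minimalFor_of_wellFoundedLT (fun g => FlowData σ π g)
      (fun g => (∑ v, |∑ a with π a = v, g a|).toNat) ⟨f, hf⟩
    refine ⟨g, hg.1, fun h hh => ?_⟩
    by_contra hlt
    push Not at hlt
    have p1 : 0 ≤ ∑ v, |∑ a with π a = v, h a| := Finset.sum_nonneg (fun _ _ => abs_nonneg _)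
    have := hg.2 hh (by simp only; omega)
    simp only at this
    omega
  clear hf f
  obtain ⟨f, hf, hmin⟩ := hmin
  obtain ⟨τ, hτ⟩ := matched_exists π f hf.pm
  have hsm := class_small σ π f τ hs hs' hev hf hτ hmin
  have hcp := class_piece σ π f τ hs hs' hev hτ
  have hcd := class_dec σ π f τ hs hs' hf.pm hf.inv hτ hsm
  have heven4 : ∀ S, Piece σ π S → S.card % 4 = 2 ∨ S.card % 4 = 0 := by
    intro S hS
    have : Even S.card := even_card_invol S σ hS.cl (fun a _ => hs a) (fun a _ => hs' a)
    obtain ⟨k, hk⟩ := this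
    omega
  let Good : Finset α → Prop := fun U => (∀ x y, (crel σ τ π) x y → x ∈ U → y ∈ U) ∧
    Piece σ π U ∧ (U.card % 4 = 2 → RDec σ π U)
  have hclass : ∀ d, Good (univ.filter (fun x => (crel σ τ π) d x)) := by
    intro d
    refine ⟨?_, hcp d, hcd d⟩
    intro x y hxy hx
    simp only [mem_filter, mem_univ, true_and] at hx ⊢
    exact (crel σ τ π).trans hx hxy
  obtain ⟨d⟩ := ‹Nonempty α›
  obtain ⟨U, hU, hmax⟩ := Finset.exists_max_image (univ.filter Good) Finset.card
    ⟨_, by rw [mem_filter]; exact ⟨mem_univ _, hclass d⟩⟩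
  simp only [mem_filter, mem_univ, true_and] at hU hmax
  obtain ⟨g1, g2, g3⟩ := hU
  have hUu : U = univ := by
    by_contra hne
    have : ∃ s ∈ U, ∃ t, t ∉ U ∧ π s = π t := by
      by_contra hno
      push Not at hno
      obtain ⟨s, hs1⟩ := g2.ne
      apply hne
      rw [Finset.eq_univ_iff_forall]
      intro b
      refine hconn (fun x => x ∈ U) (fun x hx => g2.cl x hx) ?_ s b hs1
      intro x y hxy hx
      by_contra hy
      exact hno x hx y hy hxy
    obtain ⟨s, hsU, t, htU, hst⟩ := this
    set W := univ.filter (fun x => (crel σ τ π) t x) with hW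
    obtain ⟨w1, w2, w3⟩ := hclass t
    rw [← hW] at w1 w2 w3
    have htW : t ∈ W := by simp [hW]
    have hdis : Disjoint U W := by
      rw [Finset.disjoint_left]
      intro a ha haW
      simp only [hW, mem_filter, mem_univ, true_and] at haW
      exact htU (g1 a t ((crel σ τ π).symm haW) ha)
    have hgood : Good (U ∪ W) := by
      refine ⟨?_, piece_union g2 w2 hdis ⟨s, hsU, t, htW, hst⟩, ?_⟩
      · intro x y hxy hx
        rcases mem_union.1 hx with h | h
        · exact mem_union_left _ (g1 x y hxy h)
        · exact mem_union_right _ (w1 x y hxy h)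
      · intro hc
        rw [Finset.card_union_of_disjoint hdis] at hc
        rcases heven4 U g2 with h | h <;> rcases heven4 W w2 with h' | h'
        · omega
        · exact attach (g3 h) w2 h' hdis ⟨s, hsU, t, htW, hst⟩
        · rw [Finset.union_comm]
          exact attach (w3 h') g2 h hdis.symm ⟨t, htW, s, hsU, hst.symm⟩
        · omega
    have := hmax _ hgood
    rw [Finset.card_union_of_disjoint hdis] at this
    have : 0 < W.card := Finset.card_pos.2 ⟨t, htW⟩
    omega
  rw [hUu] at g3
  exact g3 (by rw [Finset.card_univ]; exact hodd)

end

section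
open scoped Classical

/-- the subgraph spanned by a symmetric set of darts -/
def toSub {V : Type*} {G : SimpleGraph V} (S : Finset G.Dart) (hS : ∀ d ∈ S, d.symm ∈ S) :
    G.Subgraph where
  verts := {v | ∃ d ∈ S, d.fst = v}
  Adj u v := ∃ d ∈ S, d.fst = u ∧ d.snd = v
  adj_sub := by
    rintro u v ⟨d, _, rfl, rfl⟩
    exact d.adj
  edge_vert := by
    rintro u v ⟨d, hd, h, _⟩
    exact ⟨d, hd, h⟩
  symm := ⟨by
    rintro u v ⟨d, hd, rfl, rfl⟩
    exact ⟨d.symm, hS d hd, rfl, rfl⟩⟩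

lemma toSub_edgeSet {V : Type*} {G : SimpleGraph V} (S : Finset G.Dart)
    (hS : ∀ d ∈ S, d.symm ∈ S) (e : Sym2 V) :
    e ∈ (toSub S hS).edgeSet ↔ ∃ d ∈ S, d.edge = e := by
  induction e using Sym2.ind with
  | _ u v =>
    rw [Subgraph.mem_edgeSet]
    constructor
    · rintro ⟨d, hd, rfl, rfl⟩
      exact ⟨d, hd, rfl⟩
    · rintro ⟨d, hd, he⟩
      rw [dart_edge_eq_mk'_iff'] at he
      rcases he with ⟨h1, h2⟩ | ⟨h1, h2⟩
      · exact ⟨d, hd, h1, h2⟩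
      · exact ⟨d.symm, hS d hd, h2, h1⟩

lemma toSub_card {V : Type*} [Fintype V] {G : SimpleGraph V} (S : Finset G.Dart)
    (hS : ∀ d ∈ S, d.symm ∈ S) : S.card = (toSub S hS).edgeSet.ncard * 2 := by
  have h1 : (toSub S hS).edgeSet = ((S.image Dart.edge : Finset (Sym2 V)) : Set (Sym2 V)) := by
    ext e
    rw [toSub_edgeSet]; simp
  rw [h1, Set.ncard_coe_finset]
  refine Finset.card_eq_sum_card_image Dart.edge S |>.trans ?_
  refine Finset.sum_const_nat ?_
  intro e he
  obtain ⟨d, hd, rfl⟩ := Finset.mem_image.1 he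
  have : S.filter (fun x => x.edge = d.edge) = {d, d.symm} := by
    ext x
    rw [mem_filter, dart_edge_eq_iff, mem_insert, mem_singleton]
    constructor
    · exact fun h => h.2
    · rintro (rfl | rfl)
      · exact ⟨hd, Or.inl rfl⟩
      · exact ⟨hS d hd, Or.inr rfl⟩
  rw [this, Finset.card_pair (Dart.symm_ne d).symm]

lemma toSub_eulerian {V : Type*} [Fintype V] {G : SimpleGraph V} (S : Finset G.Dart)
    (hP : Piece (fun d : G.Dart => d.symm) (fun d => d.fst) S) :
    IsEulerianSubgraph G (toSub S hP.cl) := by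
  constructor
  · obtain ⟨r, hr⟩ := hP.ne
    let H := toSub S hP.cl
    have hrv : r.fst ∈ H.verts := ⟨r, hr, rfl⟩
    have key : ∀ d ∈ S, ∃ h : d.fst ∈ H.verts, H.coe.Reachable ⟨r.fst, hrv⟩ ⟨d.fst, h⟩ := by
      intro d hd
      refine hP.conn (fun d => ∃ h : d.fst ∈ H.verts, H.coe.Reachable ⟨r.fst, hrv⟩ ⟨d.fst, h⟩)
        ?_ ?_ r hr d hd ⟨hrv, Reachable.refl _⟩
      · rintro x hx ⟨h, h'⟩
        refine ⟨⟨x.symm, hP.cl x hx, rfl⟩, h'.trans ?_⟩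
        apply Adj.reachable
        rw [Subgraph.coe_adj]
        exact ⟨x, hx, rfl, rfl⟩
      · rintro x hx y hy hxy ⟨h, h'⟩
        rw [← hxy]
        exact ⟨h, h'⟩
    rw [Subgraph.connected_iff']
    have : Nonempty (toSub S hP.cl).verts := ⟨⟨r.fst, hrv⟩⟩
    refine Connected.mk ?_
    rintro ⟨u, d, hd, rfl⟩ ⟨v, d', hd', rfl⟩
    obtain ⟨_, h1⟩ := key d hd
    obtain ⟨_, h2⟩ := key d' hd'
    exact h1.symm.trans h2
  · intro v _
    have : (toSub S hP.cl).neighborSet v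
        = (((S.filter (fun d => d.fst = v)).image (fun d => d.snd) : Finset V) : Set V) := by
      ext w
      simp only [Subgraph.mem_neighborSet, coe_image, Set.mem_image, mem_coe, mem_filter]
      constructor
      · rintro ⟨d, hd, h1, h2⟩; exact ⟨d, ⟨hd, h1⟩, h2⟩
      · rintro ⟨d, ⟨hd, h1⟩, h2⟩; exact ⟨d, hd, h1, h2⟩
    rw [this, Set.ncard_coe_finset, Finset.card_image_of_injOn]
    · exact hP.ev v
    · intro x hx y hy hxy
      simp only [coe_filter, Set.mem_ofPred_eq] at hx hy
      apply Dart.ext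
      exact Prod.ext (hx.2.trans hy.2.symm) hxy

lemma sum_darts {V : Type*} [Fintype V] (G : SimpleGraph V) (F : Sym2 V → ℤ) (v : V) :
    ∑ d : G.Dart with d.fst = v, F d.edge = ∑ e ∈ G.edgeFinset.filter (fun e => v ∈ e), F e := by
  refine Finset.sum_bij (fun d _ => d.edge) ?_ ?_ ?_ ?_
  · intro d hd
    simp only [mem_filter, mem_univ, true_and] at hd
    rw [mem_filter, mem_edgeFinset]
    refine ⟨d.edge_mem, ?_⟩
    rw [← hd]
    exact Sym2.mem_mk_left _ _
  · intro d hd d' hd' h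
    simp only [mem_filter, mem_univ, true_and] at hd hd'
    rcases dart_edge_eq_iff d d' |>.1 h with h | h
    · exact h
    · exfalso
      have h2 := d'.adj
      apply h2.ne
      have h3 : d'.symm.fst = d'.snd := rfl
      rw [← h3, ← h, hd, hd']
  · intro e he
    rw [mem_filter, mem_edgeFinset] at he
    obtain ⟨he, w, rfl⟩ := he
    exact ⟨⟨(v, w), he⟩, by simp, rfl⟩
  · intro d _; rfl

theorem backward {V : Type*} [Fintype V] (G : SimpleGraph V)
    (hconn : G.Connected) (heven : ∀ v : V, Even ((G.neighborSet v).ncard))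
    (hodd : Odd G.edgeSet.ncard) (φ : Sym2 V → ℤ)
    (h1 : ∀ e ∈ G.edgeSet, φ e ≠ 0 ∧ |φ e| < 3)
    (h2 : ∀ v : V, ∑ e ∈ G.edgeFinset.filter (fun e => v ∈ e), φ e = 0) :
    ∃ D : Fin 3 → G.Subgraph, IsRootedKOddDecomposition G 3 D := by
  have hcard : Fintype.card G.Dart = 2 * G.edgeSet.ncard := by
    rw [dart_card_eq_twice_card_edges, Set.ncard_eq_toFinset_card']
    rfl
  have hne : Nonempty G.Dart := by
    rw [← Fintype.card_pos_iff, hcard]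
    have := hodd.pos
    omega
  let f : G.Dart → ℤ := fun d => if φ d.edge = 1 ∨ φ d.edge = -2 then 1 else -1
  have hfd : FlowData (fun d : G.Dart => d.symm) (fun d => d.fst) f := by
    refine ⟨?_, ?_, ?_⟩
    · intro d; simp only [f]; split_ifs <;> simp
    · intro d; simp only [f, Dart.edge_symm]
    · intro v
      have e1 := h2 v
      rw [← sum_darts] at e1
      have : (3 : ℤ) ∣ ∑ d : G.Dart with d.fst = v, (f d - φ d.edge) := by
        refine Finset.dvd_sum ?_
        intro d _
        obtain ⟨h3, h4⟩ := h1 d.edge d.edge_mem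
        rw [abs_lt] at h4
        simp only [f]
        split_ifs <;> omega
      rw [Finset.sum_sub_distrib, e1, sub_zero] at this
      exact this
  have hR := dart_main (fun d : G.Dart => d.symm) (fun d => d.fst) f (fun d => d.symm_symm)
    (fun d => d.symm_ne) ?_ hfd ?_ ?_
  · obtain ⟨D, p1, p2, p3, p4, v, p5⟩ := hR
    refine ⟨fun i => toSub (D i) (p1 i).cl, ⟨fun i => toSub_eulerian _ (p1 i), ?_, ?_, ?_⟩, v, p5⟩
    · intro i
      have e1 := toSub_card (D i) (p1 i).cl
      have e2 := p2 i
      change Odd (toSub (D i) (p1 i).cl).edgeSet.ncard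
      rw [Nat.odd_iff]
      omega
    · intro i j hij
      rw [Set.disjoint_left]
      intro e he he'
      rw [toSub_edgeSet] at he he'
      obtain ⟨d, hd, rfl⟩ := he
      obtain ⟨d', hd', h⟩ := he'
      have hdd : d ∈ D j := by
        rcases (dart_edge_eq_iff d' d).1 h with h | h
        · rwa [← h]
        · have := (p1 j).cl d' hd'
          simp only [h, Dart.symm_symm] at this
          exact this
      exact Finset.disjoint_left.1 (p3 i j hij) hd hdd
    · ext e
      rw [Set.mem_iUnion]
      constructor
      · rintro ⟨i, hi⟩
        exact (toSub (D i) (p1 i).cl).edgeSet_subset hi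
      · intro he
        induction e using Sym2.ind with
        | _ u w =>
          obtain ⟨i, hi⟩ := (p4 ⟨(u, w), he⟩).1 (mem_univ _)
          exact ⟨i, (toSub_edgeSet _ _ _).2 ⟨_, hi, rfl⟩⟩
  · intro v
    have e1 := heven v
    rw [Set.ncard_eq_toFinset_card'] at e1
    have e2 := dart_fst_fiber_card_eq_degree G v
    have e3 : Even (G.degree v) := e1
    rw [← e2] at e3
    convert e3
  · intro P hP1 hP2 a b hPa
    have hreach := (reachable_iff_reflTransGen a.fst b.fst).1 (hconn.preconnected a.fst b.fst)
    have : ∀ u, Relation.ReflTransGen G.Adj a.fst u → ∀ d : G.Dart, d.fst = u → P d := by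
      intro u hu
      induction hu with
      | refl => intro d hd; exact hP2 a d hd.symm hPa
      | tail _ huv ih =>
        rename_i u w _
        intro d hd
        have := hP1 _ (ih ⟨(u, w), huv⟩ rfl)
        exact hP2 _ d (by rw [hd]; rfl) this
    exact this _ hreach b rfl
  · rw [hcard]
    obtain ⟨k, hk⟩ := hodd
    omega

end

section
open scoped Classical

lemma countP_eq_ncard {V : Type*} [Fintype V] (K : SimpleGraph V) {u w : V} (p : K.Walk u w)
    (hp : p.IsTrail) (x : V) (hall : ∀ y, K.Adj x y → s(x, y) ∈ p.edges) :
    p.edges.countP (fun e => x ∈ e) = (K.neighborSet x).ncard := by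
  have h1 : ((p.edges.filter (fun e => x ∈ e)).toFinset : Set (Sym2 V))
      = (fun y => s(x, y)) '' (K.neighborSet x) := by
    ext e
    simp only [List.coe_toFinset, List.mem_filter, decide_eq_true_eq, Set.mem_image,
      mem_neighborSet]
    constructor
    · rintro ⟨he, y, rfl⟩
      exact ⟨y, p.edges_subset_edgeSet he, rfl⟩
    · rintro ⟨y, hy, rfl⟩
      exact ⟨hall y hy, Sym2.mem_mk_left _ _⟩
  have hnd : (p.edges.filter (fun e => x ∈ e)).Nodup := hp.edges_nodup.filter _
  rw [List.countP_eq_length_filter, ← List.toFinset_card_of_nodup hnd, ← Set.ncard_coe_finset, h1,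
    Set.ncard_image_of_injective]
  intro a b hab
  have hab2 : s(x, a) = s(x, b) := hab
  rw [Sym2.eq_iff] at hab2
  rcases hab2 with h | h
  · exact h.2
  · exact h.2.trans h.1

lemma euler {V : Type*} [Fintype V] (K : SimpleGraph V) (hev : ∀ x, Even (K.neighborSet x).ncard)
    (v : V) (hr : ∀ x y, K.Adj x y → K.Reachable v x) :
    ∃ w : K.Walk v v, w.IsTrail ∧ ∀ e ∈ K.edgeSet, e ∈ w.edges := by
  let P : ℕ → Prop := fun n => ∃ (u w : V) (p : K.Walk u w), p.IsTrail ∧ v ∈ p.support ∧ p.length = n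
  have hb : ∀ n, P n → n ≤ K.edgeFinset.card := by
    rintro n ⟨u, w, p, hp, _, rfl⟩
    exact hp.length_le_card_edgeFinset
  have h0 : P 0 := ⟨v, v, Walk.nil, Walk.IsTrail.nil, by simp, rfl⟩
  have hmax : ∃ n, P n ∧ ∀ m, P m → m ≤ n :=
    ⟨Nat.findGreatest P K.edgeFinset.card, Nat.findGreatest_spec (Nat.zero_le _) h0,
      fun m hm => Nat.le_findGreatest (hb m hm) hm⟩
  obtain ⟨n, ⟨u, w, p, hp, hv, hn⟩, hmax⟩ := hmax
  have hext : ∀ (a b : V) (q : K.Walk a b), q.IsTrail → v ∈ q.support → q.length = n →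
      ∀ y, K.Adj a y → s(a, y) ∈ q.edges := by
    intro a b q hq hvq hqn y hay
    by_contra hno
    have := hmax (n + 1) ⟨y, b, Walk.cons hay.symm q, ?_, ?_, ?_⟩
    · omega
    · rw [Walk.isTrail_cons]
      exact ⟨hq, by rwa [Sym2.eq_swap]⟩
    · rw [Walk.support_cons]; exact List.mem_cons_of_mem _ hvq
    · rw [Walk.length_cons, hqn]
  have huw : u = w := by
    by_contra hne
    have h1 := countP_eq_ncard K p hp u (hext u w p hp hv hn)
    have h2 := hp.even_countP_edges_iff u
    rw [h1] at h2
    have := h2.1 (hev u) hne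
    exact this.1 rfl
  subst huw
  have hall : ∀ a ∈ p.support, ∀ y, K.Adj a y → s(a, y) ∈ p.edges := by
    intro a ha y hay
    have h1 := hext a a (p.rotate a ha) (hp.rotate ha) ?_ (by simp [hn]) y hay
    · exact (p.rotate_edges a ha).mem_iff.1 h1
    · by_cases hav : v = a
      · subst hav; exact Walk.start_mem_support _
      · simp [Walk.mem_support_rotate_iff, hv]
  have hall' : ∀ a, K.Reachable v a → a ∈ p.support := by
    rintro a ⟨q⟩
    by_contra hno
    obtain ⟨d, _, h1, h2⟩ := q.exists_boundary_dart {x | x ∈ p.support} hv hno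
    have := hall d.fst h1 d.snd d.adj
    exact h2 (p.snd_mem_support_of_mem_edges this)
  refine ⟨p.rotate v hv, hp.rotate hv, ?_⟩
  intro e he
  rw [(p.rotate_edges v hv).mem_iff]
  induction e using Sym2.ind with
  | _ x y => exact hall x (hall' x (hr x y he)) y he

lemma alternating {V : Type*} {K : SimpleGraph V} {u x : V} (w : K.Walk u x)
    (hw : w.IsTrail) : ∃ f : Sym2 V → ℤ, (∀ e, f e = 1 ∨ f e = -1) ∧
      ∀ y, ∑ e ∈ w.edges.toFinset.filter (fun e => y ∈ e), f e
        = (if y = u then 1 else 0) - (-1) ^ w.length * (if y = x then 1 else 0) := by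
  induction w with
  | nil => exact ⟨fun _ => 1, fun _ => Or.inl rfl, fun y => by simp⟩
  | @cons u a x h p ih =>
    rw [Walk.isTrail_cons] at hw
    obtain ⟨g, hg1, hg2⟩ := ih hw.1
    refine ⟨Function.update (fun e => - g e) s(u, a) 1, ?_, ?_⟩
    · intro e
      rw [Function.update_apply]
      split_ifs
      · exact Or.inl rfl
      · rcases hg1 e with h | h <;> simp [h]
    · intro y
      have hne : s(u, a) ∉ p.edges.toFinset.filter (fun e => y ∈ e) := by
        simp [hw.2]
      have h1 : ∑ e ∈ p.edges.toFinset.filter (fun e => y ∈ e),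
          Function.update (fun e => - g e) s(u, a) 1 e =
          - ((if y = a then 1 else 0) - (-1) ^ p.length * (if y = x then 1 else 0)) := by
        rw [← hg2 y, ← Finset.sum_neg_distrib]
        refine Finset.sum_congr rfl ?_
        intro e he
        rw [Function.update_apply, if_neg]
        rintro rfl
        exact hne he
      rw [Walk.edges_cons, List.toFinset_cons, Finset.filter_insert, Walk.length_cons, pow_succ]
      have hua := h.ne
      split_ifs with hy hyu hyx hyx
      all_goals first
        | rw [Finset.sum_insert hne, h1, Function.update_self]
        | rw [h1]
      all_goals simp only [Sym2.mem_iff] at hy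
      all_goals grind

lemma sub_alt {V : Type*} [Fintype V] (G : SimpleGraph V) (H : G.Subgraph)
    (hH : IsEulerianSubgraph G H) (hodd : Odd H.edgeSet.ncard) (v : V) (hv : v ∈ H.verts) :
    ∃ f : Sym2 V → ℤ, (∀ e, f e = 1 ∨ f e = -1) ∧
      ∀ y, ∑ e ∈ H.edgeSet.toFinset.filter (fun e => y ∈ e), f e = if y = v then 2 else 0 := by
  have hmain : (∀ x, Even (H.spanningCoe.neighborSet x).ncard) →
      (∀ x y, H.spanningCoe.Adj x y → H.spanningCoe.Reachable v x) →
      ∃ f : Sym2 V → ℤ, (∀ e, f e = 1 ∨ f e = -1) ∧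
      ∀ y, ∑ e ∈ H.edgeSet.toFinset.filter (fun e => y ∈ e), f e = if y = v then 2 else 0 := by
    intro q1 q2
    obtain ⟨w, hw, hall⟩ := euler H.spanningCoe q1 v q2
    have hE : w.edges.toFinset = H.edgeSet.toFinset := by
      ext e
      rw [List.mem_toFinset, Set.mem_toFinset]
      constructor
      · intro he
        have := w.edges_subset_edgeSet he
        simpa using this
      · intro he
        exact hall e (by simpa using he)
    have hlen : w.length = H.edgeSet.ncard := by
      rw [Set.ncard_eq_toFinset_card', ← hE, List.toFinset_card_of_nodup hw.edges_nodup,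
        Walk.length_edges]
    obtain ⟨f, h1, h2⟩ := alternating w hw
    refine ⟨f, h1, fun y => ?_⟩
    rw [← hE, h2 y, hlen, hodd.neg_one_pow]
    split_ifs <;> norm_num
  apply hmain
  · intro x
    have : H.spanningCoe.neighborSet x = H.neighborSet x := by
      ext y; simp
    rw [this]
    by_cases hx : x ∈ H.verts
    · exact hH.2 x hx
    · have : H.neighborSet x = ∅ := by
        ext y
        simp only [Subgraph.mem_neighborSet, Set.mem_empty_iff_false, iff_false]
        exact fun h => hx (H.edge_vert h)
      rw [this]; simp
  · intro x y hxy
    have hx : x ∈ H.verts := H.edge_vert (by simpa using hxy)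
    let φ : H.coe →g H.spanningCoe := ⟨Subtype.val, fun {a b} h => by simpa using h⟩
    have h1 := (Subgraph.connected_iff'.1 hH.1).preconnected ⟨v, hv⟩ ⟨x, hx⟩
    exact h1.map φ

theorem forward {V : Type*} [Fintype V] (G : SimpleGraph V)
    (D : Fin 3 → G.Subgraph) (hD : IsRootedKOddDecomposition G 3 D) :
    Odd G.edgeSet.ncard ∧ ∃ φ : Sym2 V → ℤ,
      (∀ e ∈ G.edgeSet, φ e ≠ 0 ∧ |φ e| < 3) ∧
      (∀ v : V, ∑ e ∈ G.edgeFinset.filter (fun e => v ∈ e), φ e = 0) := by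
  obtain ⟨⟨h1, h2, h3, h4⟩, v, hv⟩ := hD
  let E : Fin 3 → Finset (Sym2 V) := fun i => (D i).edgeSet.toFinset
  have hEm : ∀ i e, e ∈ E i ↔ e ∈ (D i).edgeSet := fun i e => by simp [E]
  have hEd : ∀ i j, i ≠ j → Disjoint (E i) (E j) := by
    intro i j hij
    rw [Finset.disjoint_left]
    intro e hi hj
    rw [hEm] at hi hj
    exact Set.disjoint_left.1 (h3 i j hij) hi hj
  have hEu : G.edgeFinset = univ.biUnion E := by
    ext e
    rw [mem_edgeFinset, ← h4, Set.mem_iUnion]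
    simp [hEm]
  have hEc : ∀ i, Odd (E i).card := by
    intro i
    have := h2 i
    rwa [Set.ncard_eq_toFinset_card'] at this
  constructor
  · have : G.edgeSet.ncard = G.edgeFinset.card := by
      rw [Set.ncard_eq_toFinset_card']; rfl
    rw [this, hEu, Finset.card_biUnion (fun i _ j _ hij => hEd i j hij), Fin.sum_univ_three]
    exact ((hEc 0).add_odd (hEc 1)).add_odd (hEc 2)
  · have hex := fun i => sub_alt G (D i) (h1 i) (h2 i) v (hv i)
    choose f hf1 hf2 using hex
    let c : Fin 3 → ℤ := ![1, 1, -2]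
    let φ : Sym2 V → ℤ := fun e => ∑ i, if e ∈ E i then c i * f i e else 0
    have hφ : ∀ i, ∀ e ∈ E i, φ e = c i * f i e := by
      intro i e he
      simp only [φ]
      rw [Finset.sum_eq_single i]
      · rw [if_pos he]
      · intro j _ hji
        rw [if_neg]
        intro hj
        exact Finset.disjoint_left.1 (hEd j i hji) hj he
      · simp
    refine ⟨φ, ?_, ?_⟩
    · intro e he
      rw [← mem_edgeFinset, hEu, Finset.mem_biUnion] at he
      obtain ⟨i, _, hi⟩ := he
      rw [hφ i e hi]
      fin_cases i <;> simp only [c] <;> rcases hf1 _ e with h | h <;> rw [h] <;> simp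
    · intro y
      rw [hEu, Finset.filter_biUnion, Finset.sum_biUnion]
      · have : ∀ i, ∑ e ∈ (E i).filter (fun e => y ∈ e), φ e = c i * (if y = v then 2 else 0) := by
          intro i
          rw [← hf2 i y, Finset.mul_sum]
          exact Finset.sum_congr rfl (fun e he => hφ i e (mem_filter.1 he).1)
        rw [Finset.sum_congr rfl (fun i _ => this i), Fin.sum_univ_three]
        simp only [c]
        split_ifs <;> simp
      · intro i _ j _ hij
        exact Finset.disjoint_filter_filter (hEd i j hij)

end

end OddDec

/-- An eulerian graph admits a rooted 3-odd decomposition iff it has an odd number of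
edges and admits an undirected nowhere-zero integer 3-flow. -/
theorem rooted3OddDecomposition_iff_nowhereZero3Flow {V : Type*} [Fintype V]
    [DecidableEq V] (G : SimpleGraph V) [DecidableRel G.Adj]
    (hconn : G.Connected) (heven : ∀ v : V, Even ((G.neighborSet v).ncard)) :
    (∃ D : Fin 3 → G.Subgraph, IsRootedKOddDecomposition G 3 D) ↔
      (Odd G.edgeSet.ncard ∧
        ∃ φ : Sym2 V → ℤ,
          (∀ e ∈ G.edgeSet, φ e ≠ 0 ∧ |φ e| < 3) ∧
          (∀ v : V, ∑ e ∈ G.edgeFinset.filter (fun e => v ∈ e), φ e = 0)) := by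
  constructor
  · rintro ⟨D, hD⟩
    obtain ⟨h1, φ, h2, h3⟩ := OddDec.forward G D hD
    refine ⟨h1, φ, h2, fun v => ?_⟩
    convert h3 v
  · rintro ⟨h1, φ, h2, h3⟩
    refine OddDec.backward G hconn heven h1 φ h2 (fun v => ?_)
    convert h3 v
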